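/- arXiv:1907.01310 — 2 statements merged into one kernel-verified Lean document; each statement's English description precedes it below -/
import Mathlib

section
/- Let E be a TOM on a finite vertex set V with internal space ℂ^d admitting an overlapping decomposition with overlap V₀ given by TOMs E_L, E_R, E₀ along a partition V = V₋ ∪ V₀ ∪ V₊. Then for every density ρ supported on the sum of sites S₀ indexed by V₀, the expected return times satisfy τ(ρ→S₀) + 1 = τ_L(ρ→S₀) + τ_R(ρ→S₀) as elements of [1, ∞] (in particular the left side is infinite iff one of the right-hand terms is). Consequently S₀ is positive recurrent for E if and only if S₀ is positive recurrent for both E_L and E_R. -/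
open Matrix Filter
open scoped ComplexOrder ENNReal

namespace QMCTOM

variable {d : ℕ} {V : Type} [Fintype V] [DecidableEq V]

/-- A completely positive map on `M_d(ℂ)`: one admitting a finite Kraus
representation. -/
def IsCPMap (Φ : Matrix (Fin d) (Fin d) ℂ →ₗ[ℂ] Matrix (Fin d) (Fin d) ℂ) : Prop :=
  ∃ (m : ℕ) (B : Fin m → Matrix (Fin d) (Fin d) ℂ),
    ∀ ρ, Φ ρ = ∑ i, B i * ρ * (B i)ᴴ

/-- A transition operator matrix (TOM) supported on a subset `S` of the vertex
set `V`: a family of CP maps `E i j`, vanishing unless `i, j ∈ S`, whose column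
sums over `S` are trace preserving. A TOM on `V` itself corresponds to
`S = Finset.univ`. -/
def IsTOMOn (S : Finset V)
    (E : V → V → (Matrix (Fin d) (Fin d) ℂ →ₗ[ℂ] Matrix (Fin d) (Fin d) ℂ)) : Prop :=
  (∀ i j, IsCPMap (E i j)) ∧
  (∀ i j, (i ∉ S ∨ j ∉ S) → E i j = 0) ∧
  (∀ j ∈ S, ∀ ρ : Matrix (Fin d) (Fin d) ℂ, (∑ i, (E i j) ρ).trace = ρ.trace)

/-- The action of a TOM on block-diagonal operators `(ρ_j)_{j∈V}`:
`(Eρ)_i = Σ_j E_i^j(ρ_j)`. -/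
noncomputable def tomAct
    (E : V → V → (Matrix (Fin d) (Fin d) ℂ →ₗ[ℂ] Matrix (Fin d) (Fin d) ℂ)) :
    (V → Matrix (Fin d) (Fin d) ℂ) →ₗ[ℂ] (V → Matrix (Fin d) (Fin d) ℂ) where
  toFun ρ i := ∑ j, E i j (ρ j)
  map_add' x y := by
    funext i
    simp [map_add, Finset.sum_add_distrib]
  map_smul' c x := by
    funext i
    simp [_root_.map_smul, Finset.smul_sum]

/-- The projection `ℙ₀` of block-diagonal operators zeroing all components
outside `S`. -/
noncomputable def siteProj (S : Finset V) :
    (V → Matrix (Fin d) (Fin d) ℂ) →ₗ[ℂ] (V → Matrix (Fin d) (Fin d) ℂ) where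
  toFun ρ i := if i ∈ S then ρ i else 0
  map_add' x y := by
    funext i
    by_cases h : i ∈ S <;> simp [h]
  map_smul' c x := by
    funext i
    by_cases h : i ∈ S <;> simp [h]

/-- Total trace of a block-diagonal operator. -/
noncomputable def blockTrace (ρ : V → Matrix (Fin d) (Fin d) ℂ) : ℂ :=
  ∑ i, (ρ i).trace

/-- `retA E S n` is `𝔸_{n+1} = ℙ₀ ∘ E ∘ (ℚ₀∘E)^n ∘ ℙ₀`, where `ℙ₀ = siteProj S`
and `ℚ₀ = id − ℙ₀`. -/
noncomputable def retA
    (E : V → V → (Matrix (Fin d) (Fin d) ℂ →ₗ[ℂ] Matrix (Fin d) (Fin d) ℂ))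
    (S : Finset V) (n : ℕ) :
    (V → Matrix (Fin d) (Fin d) ℂ) →ₗ[ℂ] (V → Matrix (Fin d) (Fin d) ℂ) :=
  (siteProj S) ∘ₗ (tomAct E) ∘ₗ
    (((LinearMap.id - siteProj S) ∘ₗ tomAct E) ^ n) ∘ₗ (siteProj S)

/-- A density supported on the sum of sites indexed by `S`. -/
def DensityOn (S : Finset V) (ρ : V → Matrix (Fin d) (Fin d) ℂ) : Prop :=
  (∀ j, (ρ j).PosSemidef) ∧ (∀ j ∉ S, ρ j = 0) ∧ blockTrace ρ = 1

/-- Return probability `π(ρ→S₀) = Σ_{n≥1} Tr(𝔸_n(ρ))`. -/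
noncomputable def returnProb
    (E : V → V → (Matrix (Fin d) (Fin d) ℂ →ₗ[ℂ] Matrix (Fin d) (Fin d) ℂ))
    (S : Finset V) (ρ : V → Matrix (Fin d) (Fin d) ℂ) : ℝ :=
  ∑' n : ℕ, (blockTrace ((retA E S n) ρ)).re

/-- Expected return time `τ(ρ→S₀) = Σ_{n≥1} n·Tr(𝔸_n(ρ))` if `π(ρ→S₀) = 1`,
and `∞` otherwise. -/
noncomputable def expReturnTime
    (E : V → V → (Matrix (Fin d) (Fin d) ℂ →ₗ[ℂ] Matrix (Fin d) (Fin d) ℂ))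
    (S : Finset V) (ρ : V → Matrix (Fin d) (Fin d) ℂ) : ℝ≥0∞ :=
  if returnProb E S ρ = 1 then
    ∑' n : ℕ, ENNReal.ofReal ((n + 1) * (blockTrace ((retA E S n) ρ)).re)
  else ⊤

/-- The sum of sites `S` is recurrent for `E`. -/
def RecurrentOn
    (E : V → V → (Matrix (Fin d) (Fin d) ℂ →ₗ[ℂ] Matrix (Fin d) (Fin d) ℂ))
    (S : Finset V) : Prop :=
  ∀ ρ, DensityOn S ρ → returnProb E S ρ = 1

/-- The sum of sites `S` is positive recurrent for `E`. -/
def PosRecurrentOn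
    (E : V → V → (Matrix (Fin d) (Fin d) ℂ →ₗ[ℂ] Matrix (Fin d) (Fin d) ℂ))
    (S : Finset V) : Prop :=
  ∀ ρ, DensityOn S ρ → expReturnTime E S ρ < ⊤


/-- One step of the evolution conditioned on avoiding the sites in `S`: the map `ℚ₀ ∘ E`. -/
noncomputable def avoidStep
    (E : V → V → (Matrix (Fin d) (Fin d) ℂ →ₗ[ℂ] Matrix (Fin d) (Fin d) ℂ)) (S : Finset V) :
    (V → Matrix (Fin d) (Fin d) ℂ) →ₗ[ℂ] (V → Matrix (Fin d) (Fin d) ℂ) :=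
  (LinearMap.id - siteProj S) ∘ₗ tomAct E

/-- The probability of not having returned to `S` within the first `n` steps. -/
noncomputable def survival
    (E : V → V → (Matrix (Fin d) (Fin d) ℂ →ₗ[ℂ] Matrix (Fin d) (Fin d) ℂ))
    (S : Finset V) (ρ : V → Matrix (Fin d) (Fin d) ℂ) (n : ℕ) : ℝ :=
  (blockTrace ((avoidStep E S ^ n) ρ)).re

lemma tomAct_apply
    (E : V → V → (Matrix (Fin d) (Fin d) ℂ →ₗ[ℂ] Matrix (Fin d) (Fin d) ℂ))
    (ρ : V → Matrix (Fin d) (Fin d) ℂ) (i : V) : tomAct E ρ i = ∑ j, E i j (ρ j) := rfl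

lemma siteProj_apply (S : Finset V) (ρ : V → Matrix (Fin d) (Fin d) ℂ) (i : V) :
    siteProj S ρ i = if i ∈ S then ρ i else 0 := rfl

lemma avoidStep_apply
    (E : V → V → (Matrix (Fin d) (Fin d) ℂ →ₗ[ℂ] Matrix (Fin d) (Fin d) ℂ)) (S : Finset V)
    (ρ : V → Matrix (Fin d) (Fin d) ℂ) (i : V) :
    avoidStep E S ρ i = if i ∈ S then 0 else tomAct E ρ i := by
  by_cases h : i ∈ S <;> simp [avoidStep, siteProj_apply, h]

lemma blockTrace_add (x y : V → Matrix (Fin d) (Fin d) ℂ) :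
    blockTrace (x + y) = blockTrace x + blockTrace y := by
  simp [blockTrace, Finset.sum_add_distrib]

lemma IsCPMap.posSemidef {Φ : Matrix (Fin d) (Fin d) ℂ →ₗ[ℂ] Matrix (Fin d) (Fin d) ℂ}
    (hΦ : IsCPMap Φ) {ρ : Matrix (Fin d) (Fin d) ℂ} (hρ : ρ.PosSemidef) :
    (Φ ρ).PosSemidef := by
  obtain ⟨m, B, hB⟩ := hΦ
  rw [hB]
  exact posSemidef_sum _ fun i _ => hρ.mul_mul_conjTranspose_same (B i)

lemma tomAct_posSemidef
    {E : V → V → (Matrix (Fin d) (Fin d) ℂ →ₗ[ℂ] Matrix (Fin d) (Fin d) ℂ)}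
    (hE : ∀ i j, IsCPMap (E i j)) {ρ : V → Matrix (Fin d) (Fin d) ℂ}
    (hρ : ∀ j, (ρ j).PosSemidef) (i : V) : (tomAct E ρ i).PosSemidef :=
  posSemidef_sum _ fun j _ => (hE i j).posSemidef (hρ j)

lemma avoidStep_pow_posSemidef
    {E : V → V → (Matrix (Fin d) (Fin d) ℂ →ₗ[ℂ] Matrix (Fin d) (Fin d) ℂ)}
    (hE : ∀ i j, IsCPMap (E i j)) (S : Finset V) {ρ : V → Matrix (Fin d) (Fin d) ℂ}
    (hρ : ∀ j, (ρ j).PosSemidef) (n : ℕ) (i : V) :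
    ((avoidStep E S ^ n) ρ i).PosSemidef := by
  induction n generalizing i with
  | zero => simpa using hρ i
  | succ n ih =>
    rw [pow_succ', Module.End.mul_apply, avoidStep_apply]
    split_ifs
    · exact PosSemidef.zero
    · exact tomAct_posSemidef hE ih i

lemma blockTrace_re_nonneg {ρ : V → Matrix (Fin d) (Fin d) ℂ}
    (hρ : ∀ j, (ρ j).PosSemidef) : 0 ≤ (blockTrace ρ).re := by
  have h : 0 ≤ blockTrace ρ := Finset.sum_nonneg fun i _ => (hρ i).trace_nonneg
  exact (Complex.le_def.1 h).1

lemma IsTOMOn.blockTrace_tomAct {T : Finset V}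
    {E : V → V → (Matrix (Fin d) (Fin d) ℂ →ₗ[ℂ] Matrix (Fin d) (Fin d) ℂ)}
    (hE : IsTOMOn T E) {ρ : V → Matrix (Fin d) (Fin d) ℂ} (hρ : ∀ j ∉ T, ρ j = 0) :
    blockTrace (tomAct E ρ) = blockTrace ρ := by
  simp only [blockTrace, tomAct_apply, trace_sum]
  rw [Finset.sum_comm]
  refine Finset.sum_congr rfl fun j _ => ?_
  by_cases hj : j ∈ T
  · rw [← trace_sum, hE.2.2 j hj]
  · simp [hρ j hj]

lemma IsTOMOn.avoidStep_pow_eq_zero {T : Finset V}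
    {E : V → V → (Matrix (Fin d) (Fin d) ℂ →ₗ[ℂ] Matrix (Fin d) (Fin d) ℂ)}
    (hE : IsTOMOn T E) (S : Finset V) {ρ : V → Matrix (Fin d) (Fin d) ℂ}
    (hρ : ∀ j ∉ T, ρ j = 0) (n : ℕ) : ∀ j ∉ T, (avoidStep E S ^ n) ρ j = 0 := by
  intro j hj
  cases n with
  | zero => simpa using hρ j hj
  | succ n =>
    rw [pow_succ', Module.End.mul_apply, avoidStep_apply, tomAct_apply]
    simp [hE.2.1 j _ (Or.inl hj)]

lemma retA_apply
    (E : V → V → (Matrix (Fin d) (Fin d) ℂ →ₗ[ℂ] Matrix (Fin d) (Fin d) ℂ)) {S : Finset V}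
    {ρ : V → Matrix (Fin d) (Fin d) ℂ} (hρ : ∀ j ∉ S, ρ j = 0) (n : ℕ) :
    retA E S n ρ = siteProj S (tomAct E ((avoidStep E S ^ n) ρ)) := by
  have h : siteProj S ρ = ρ := by
    funext i
    by_cases hi : i ∈ S <;> simp [siteProj_apply, hi, hρ]
  simp only [retA, LinearMap.comp_apply, h]
  rfl

lemma IsTOMOn.blockTrace_retA {S T : Finset V}
    {E : V → V → (Matrix (Fin d) (Fin d) ℂ →ₗ[ℂ] Matrix (Fin d) (Fin d) ℂ)}
    (hE : IsTOMOn T E) (hST : S ⊆ T) {ρ : V → Matrix (Fin d) (Fin d) ℂ}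
    (hρ : ∀ j ∉ S, ρ j = 0) (n : ℕ) :
    (blockTrace (retA E S n ρ)).re = survival E S ρ n - survival E S ρ (n + 1) := by
  have hT := hE.avoidStep_pow_eq_zero S (fun j hj => hρ j fun h => hj (hST h)) n
  have hsplit : tomAct E ((avoidStep E S ^ n) ρ) =
      retA E S n ρ + (avoidStep E S ^ (n + 1)) ρ := by
    rw [retA_apply E hρ, pow_succ', Module.End.mul_apply]
    simp [avoidStep]
  have h := hE.blockTrace_tomAct hT
  rw [hsplit, blockTrace_add] at h
  rw [survival, survival, ← h, Complex.add_re]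
  ring

open Finset.HasAntidiagonal in
/-- Summation by parts for a nonnegative decreasing sequence, in `[0, ∞]`: the sum of a
tail function is the mean of the distribution it describes. -/
lemma tsum_ofReal_of_tendsto_zero {s : ℕ → ℝ} (hs : Antitone s)
    (h0 : Tendsto s atTop (nhds 0)) :
    ∑' n : ℕ, ENNReal.ofReal ((n + 1) * (s n - s (n + 1))) = ∑' n, ENNReal.ofReal (s n) := by
  have hnn : ∀ n, 0 ≤ s n - s (n + 1) := fun n => sub_nonneg.2 (hs n.le_succ)
  have htail : ∀ n, ENNReal.ofReal (s n) =
      ∑' k, ENNReal.ofReal (s (n + k) - s (n + k + 1)) := by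
    intro n
    have hsum : HasSum (fun k => s (n + k) - s (n + k + 1)) (s n) := by
      rw [hasSum_iff_tendsto_nat_of_nonneg fun k => hnn (n + k)]
      have : ∀ N, ∑ k ∈ Finset.range N, (s (n + k) - s (n + k + 1)) = s n - s (n + N) :=
        fun N => Finset.sum_range_sub' (fun k => s (n + k)) N
      simp only [this]
      have h := (h0.comp (tendsto_add_atTop_nat n)).const_sub (s n)
      simpa [Function.comp_def, add_comm] using h
    rw [← hsum.tsum_eq, ENNReal.ofReal_tsum_of_nonneg (fun k => hnn (n + k)) hsum.summable]
  simp_rw [htail]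
  rw [← ENNReal.tsum_prod, ← (sigmaAntidiagonalEquivProd (A := ℕ)).tsum_eq, ENNReal.tsum_sigma']
  refine tsum_congr fun n => ?_
  have hterm : ∀ p : antidiagonal n,
      ENNReal.ofReal (s ((sigmaAntidiagonalEquivProd ⟨n, p⟩).1 +
        (sigmaAntidiagonalEquivProd ⟨n, p⟩).2) -
        s ((sigmaAntidiagonalEquivProd ⟨n, p⟩).1 +
        (sigmaAntidiagonalEquivProd ⟨n, p⟩).2 + 1)) =
      ENNReal.ofReal (s n - s (n + 1)) := by
    rintro ⟨p, hp⟩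
    rw [mem_antidiagonal] at hp
    simp [hp]
  rw [tsum_congr hterm, tsum_fintype, Finset.sum_const, Finset.card_univ, Fintype.card_coe,
    Finset.Nat.card_antidiagonal, ENNReal.ofReal_mul (by positivity), nsmul_eq_mul]
  congr 1
  rw [← Nat.cast_succ, ENNReal.ofReal_natCast]

/-- The expected return time is the sum of the survival probabilities. -/
lemma IsTOMOn.expReturnTime_eq_tsum_survival {S T : Finset V}
    {E : V → V → (Matrix (Fin d) (Fin d) ℂ →ₗ[ℂ] Matrix (Fin d) (Fin d) ℂ)}
    (hE : IsTOMOn T E) (hST : S ⊆ T) {ρ : V → Matrix (Fin d) (Fin d) ℂ}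
    (hρ : DensityOn S ρ) :
    expReturnTime E S ρ = ∑' n, ENNReal.ofReal (survival E S ρ n) := by
  obtain ⟨hpos, hsupp, htr⟩ := hρ
  have hret := hE.blockTrace_retA hST hsupp
  have hnn : ∀ n, 0 ≤ survival E S ρ n := fun n =>
    blockTrace_re_nonneg (avoidStep_pow_posSemidef hE.1 S hpos n)
  have hdiff : ∀ n, 0 ≤ survival E S ρ n - survival E S ρ (n + 1) := by
    intro n
    rw [← hret, retA_apply E hsupp]
    refine blockTrace_re_nonneg fun i => ?_
    rw [siteProj_apply]
    split_ifs
    · exact tomAct_posSemidef hE.1 (avoidStep_pow_posSemidef hE.1 S hpos n) i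
    · exact PosSemidef.zero
  have hanti : Antitone (survival E S ρ) := antitone_nat_of_succ_le fun n => sub_nonneg.1 (hdiff n)
  have hzero : survival E S ρ 0 = 1 := by simp [survival, htr]
  have hlim := tendsto_atTop_ciInf hanti ⟨0, by rintro _ ⟨n, rfl⟩; exact hnn n⟩
  set l := ⨅ n, survival E S ρ n
  have hprob : returnProb E S ρ = 1 - l := by
    have hsum : HasSum (fun n => survival E S ρ n - survival E S ρ (n + 1)) (1 - l) := by
      rw [hasSum_iff_tendsto_nat_of_nonneg hdiff]
      simp only [Finset.sum_range_sub', hzero]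
      exact hlim.const_sub 1
    simp only [returnProb, hret]
    exact hsum.tsum_eq
  rw [expReturnTime, hprob]
  simp only [hret]
  split_ifs with h
  · have hl : l = 0 := by linarith
    rw [hl] at hlim
    exact tsum_ofReal_of_tendsto_zero hanti hlim
  · symm
    by_contra hfin
    have h1 := ENNReal.tendsto_atTop_zero_of_tsum_ne_top hfin
    have h2 := tendsto_nhds_unique h1 (ENNReal.tendsto_ofReal hlim)
    have h3 : l ≤ 0 := ENNReal.ofReal_eq_zero.1 h2.symm
    have h4 : 0 ≤ l := le_ciInf hnn
    exact h (by linarith)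

/-- After at least one step, the part of the evolution that has not yet returned to the overlap
is the sum of the corresponding parts of the two components. -/
lemma avoidStep_pow_succ_decomposition {Vm V0 Vp : Finset V}
    (hd3 : Disjoint Vm Vp)
    {E EL ER E0 : V → V → (Matrix (Fin d) (Fin d) ℂ →ₗ[ℂ] Matrix (Fin d) (Fin d) ℂ)}
    (hL : ∀ i j, (i ∉ Vm ∪ V0 ∨ j ∉ Vm ∪ V0) → EL i j = 0)
    (hR : ∀ i j, (i ∉ V0 ∪ Vp ∨ j ∉ V0 ∪ Vp) → ER i j = 0)
    (h0 : ∀ i j, (i ∉ V0 ∨ j ∉ V0) → E0 i j = 0)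
    (hdec : ∀ i j, E i j = EL i j + ER i j - E0 i j)
    (ρ : V → Matrix (Fin d) (Fin d) ℂ) (n : ℕ) :
    (avoidStep E V0 ^ (n + 1)) ρ =
      (avoidStep EL V0 ^ (n + 1)) ρ + (avoidStep ER V0 ^ (n + 1)) ρ := by
  have hstep : avoidStep E V0 = avoidStep EL V0 + avoidStep ER V0 := by
    refine LinearMap.ext fun x => funext fun i => ?_
    by_cases hi : i ∈ V0
    · simp [avoidStep_apply, hi]
    · simp [avoidStep_apply, hi, tomAct_apply, hdec, h0 i _ (Or.inl hi), Finset.sum_add_distrib]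
  have hLR : avoidStep EL V0 * avoidStep ER V0 = 0 := by
    refine LinearMap.ext fun x => funext fun i => ?_
    rw [Module.End.mul_apply, avoidStep_apply]
    split_ifs with hi
    · rfl
    refine Finset.sum_eq_zero fun j _ => ?_
    by_cases hj : j ∈ Vm ∪ V0
    · have : avoidStep ER V0 x j = 0 := by
        rw [avoidStep_apply]
        split_ifs with hj0
        · rfl
        · have hjp : j ∉ V0 ∪ Vp := by
            have hjm : j ∈ Vm := (Finset.mem_union.1 hj).resolve_right hj0
            simp [hj0, Finset.disjoint_left.1 hd3 hjm]
          simp [tomAct_apply, hR j _ (Or.inl hjp)]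
      simp [this]
    · simp [hL i j (Or.inr hj)]
  have hRL : avoidStep ER V0 * avoidStep EL V0 = 0 := by
    refine LinearMap.ext fun x => funext fun i => ?_
    rw [Module.End.mul_apply, avoidStep_apply]
    split_ifs with hi
    · rfl
    refine Finset.sum_eq_zero fun j _ => ?_
    by_cases hj : j ∈ V0 ∪ Vp
    · have : avoidStep EL V0 x j = 0 := by
        rw [avoidStep_apply]
        split_ifs with hj0
        · rfl
        · have hjm : j ∉ Vm ∪ V0 := by
            have hjp : j ∈ Vp := (Finset.mem_union.1 hj).resolve_left hj0
            simp [hj0, Finset.disjoint_right.1 hd3 hjp]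
          simp [tomAct_apply, hL j _ (Or.inl hjm)]
      simp [this]
    · simp [hR i j (Or.inr hj)]
  have hpow : avoidStep E V0 ^ (n + 1) = avoidStep EL V0 ^ (n + 1) + avoidStep ER V0 ^ (n + 1) := by
    rw [hstep]
    induction n with
    | zero => simp
    | succ n ih =>
      have h1 : avoidStep EL V0 * avoidStep ER V0 ^ (n + 1) = 0 := by
        rw [pow_succ', ← mul_assoc, hLR, zero_mul]
      have h2 : avoidStep ER V0 * avoidStep EL V0 ^ (n + 1) = 0 := by
        rw [pow_succ', ← mul_assoc, hRL, zero_mul]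
      rw [pow_succ', ih, add_mul, mul_add, mul_add, h1, h2, ← pow_succ', ← pow_succ', add_zero,
        zero_add]
  rw [hpow, LinearMap.add_apply]

/-- Decomposition rule for the expected return time: if a TOM
`E` has an overlapping decomposition with overlap `V₀`, then
`τ(ρ→S₀) + 1 = τ_L(ρ→S₀) + τ_R(ρ→S₀)` in `[1,∞]` for every density `ρ` supported
on `S₀`; consequently `S₀` is positive recurrent for `E` iff it is positive
recurrent for both `E_L` and `E_R`. -/
theorem tom_decomposition_expected_return_time
    (Vm V0 Vp : Finset V)
    (hd1 : Disjoint Vm V0) (hd2 : Disjoint V0 Vp) (hd3 : Disjoint Vm Vp)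
    (hcover : Vm ∪ V0 ∪ Vp = Finset.univ)
    (E EL ER E0 : V → V → (Matrix (Fin d) (Fin d) ℂ →ₗ[ℂ] Matrix (Fin d) (Fin d) ℂ))
    (hE : IsTOMOn Finset.univ E)
    (hL : IsTOMOn (Vm ∪ V0) EL) (hR : IsTOMOn (V0 ∪ Vp) ER) (h0 : IsTOMOn V0 E0)
    (hdec : ∀ i j, E i j = EL i j + ER i j - E0 i j) :
    (∀ ρ, DensityOn V0 ρ →
      expReturnTime E V0 ρ + 1 = expReturnTime EL V0 ρ + expReturnTime ER V0 ρ) ∧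
    (PosRecurrentOn E V0 ↔ PosRecurrentOn EL V0 ∧ PosRecurrentOn ER V0) := by
  have htime : ∀ ρ, DensityOn V0 ρ →
      expReturnTime E V0 ρ + 1 = expReturnTime EL V0 ρ + expReturnTime ER V0 ρ := by
    intro ρ hρ
    have hzero : ∀ F : V → V → (Matrix (Fin d) (Fin d) ℂ →ₗ[ℂ] Matrix (Fin d) (Fin d) ℂ),
        ENNReal.ofReal (survival F V0 ρ 0) = 1 := fun F => by simp [survival, hρ.2.2]
    have hsucc : ∀ n, ENNReal.ofReal (survival E V0 ρ (n + 1)) =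
        ENNReal.ofReal (survival EL V0 ρ (n + 1)) + ENNReal.ofReal (survival ER V0 ρ (n + 1)) := by
      intro n
      simp only [survival]
      rw [← ENNReal.ofReal_add
        (blockTrace_re_nonneg (avoidStep_pow_posSemidef hL.1 V0 hρ.1 (n + 1)))
        (blockTrace_re_nonneg (avoidStep_pow_posSemidef hR.1 V0 hρ.1 (n + 1)))]
      rw [avoidStep_pow_succ_decomposition hd3 hL.2.1 hR.2.1 h0.2.1 hdec,
        blockTrace_add, Complex.add_re]
    rw [hE.expReturnTime_eq_tsum_survival (Finset.subset_univ V0) hρ,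
      hL.expReturnTime_eq_tsum_survival Finset.subset_union_right hρ,
      hR.expReturnTime_eq_tsum_survival Finset.subset_union_left hρ,
      tsum_eq_zero_add' ENNReal.summable, tsum_eq_zero_add' (f := fun n =>
        ENNReal.ofReal (survival EL V0 ρ n)) ENNReal.summable,
      tsum_eq_zero_add' (f := fun n => ENNReal.ofReal (survival ER V0 ρ n)) ENNReal.summable]
    simp only [hzero, hsucc, ENNReal.tsum_add]
    ring
  have hfin : ∀ ρ, DensityOn V0 ρ → (expReturnTime E V0 ρ < ⊤ ↔
      expReturnTime EL V0 ρ < ⊤ ∧ expReturnTime ER V0 ρ < ⊤) := by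
    intro ρ hρ
    rw [← ENNReal.add_lt_top, ← htime ρ hρ, ENNReal.add_lt_top]
    simp
  refine ⟨htime, fun h => ⟨fun ρ hρ => ((hfin ρ hρ).1 (h ρ hρ)).1,
    fun ρ hρ => ((hfin ρ hρ).1 (h ρ hρ)).2⟩, fun h ρ hρ => (hfin ρ hρ).2 ⟨h.1 ρ hρ, h.2 ρ hρ⟩⟩

end QMCTOM
end

section
/- Let E = (E_i^j)_{i,j∈V} be a TOM on a finite vertex set V with internal space ℂ^d, and let V = V₋ ∪ V₀ ∪ V₊ be a partition with V_L = V₋ ∪ V₀ and V_R = V₀ ∪ V₊. Then E admits an overlapping factorization E = (E_L ⊕ I₊)(I₋ ⊕ E_R) with overlap V₀ (for some TOMs E_L on V_L and E_R on V_R) if and only if: (i) E_i^j = 0 for all i ∈ V₊, j ∈ V₋; and (ii) there exist completely positive maps U_i^k on M_d(ℂ) (i ∈ V_L, k ∈ V₀) and completely positive maps Φ_k^j on M_d(ℂ) (k ∈ V₀, j ∈ V_R) such that E_i^j = Σ_{k∈V₀} U_i^k ∘ Φ_k^j for all i ∈ V_L and j ∈ V_R (i.e. the columns of the block (E_i^j)_{i∈V_L,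 j∈V_R} have rank at most |V₀| as CP vectors). -/
open Matrix Filter
open scoped ComplexOrder ENNReal

namespace QMCTOM

variable {d : ℕ} {V : Type} [Fintype V] [DecidableEq V]

/-- Extension of a (zero-extended) TOM by the identity on the sites in `S`:
the matrix of maps `E ⊕ I_S` with entries `E i j` plus the identity on the
diagonal entries indexed by `S`. -/
noncomputable def extById (S : Finset V)
    (E : V → V → (Matrix (Fin d) (Fin d) ℂ →ₗ[ℂ] Matrix (Fin d) (Fin d) ℂ)) :
    V → V → (Matrix (Fin d) (Fin d) ℂ →ₗ[ℂ] Matrix (Fin d) (Fin d) ℂ) :=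
  fun i j => E i j + (if i = j ∧ i ∈ S then LinearMap.id else 0)

/-- Conjugation `ρ ↦ X ρ Xᴴ` as a linear map. -/
def conjMap (X : Matrix (Fin d) (Fin d) ℂ) :
    Matrix (Fin d) (Fin d) ℂ →ₗ[ℂ] Matrix (Fin d) (Fin d) ℂ where
  toFun ρ := X * ρ * Xᴴ
  map_add' x y := by simp [mul_add, add_mul]
  map_smul' c x := by simp

lemma IsCPMap.of_fintype {ι : Type*} [Fintype ι]
    {Φ : Matrix (Fin d) (Fin d) ℂ →ₗ[ℂ] Matrix (Fin d) (Fin d) ℂ}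
    (B : ι → Matrix (Fin d) (Fin d) ℂ) (h : ∀ ρ, Φ ρ = ∑ i, B i * ρ * (B i)ᴴ) :
    IsCPMap Φ :=
  ⟨Fintype.card ι, B ∘ (Fintype.equivFin ι).symm, fun ρ => by
    rw [h, ← (Fintype.equivFin ι).symm.sum_comp]
    rfl⟩

lemma isCPMap_conjMap (X : Matrix (Fin d) (Fin d) ℂ) : IsCPMap (conjMap X) :=
  .of_fintype (fun _ : Unit => X) fun ρ => by simp [conjMap]

lemma isCPMap_zero :
    IsCPMap (0 : Matrix (Fin d) (Fin d) ℂ →ₗ[ℂ] Matrix (Fin d) (Fin d) ℂ) :=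
  .of_fintype (fun i : Empty => i.elim) fun ρ => by simp

lemma IsCPMap.add {Φ Ψ : Matrix (Fin d) (Fin d) ℂ →ₗ[ℂ] Matrix (Fin d) (Fin d) ℂ}
    (hΦ : IsCPMap Φ) (hΨ : IsCPMap Ψ) : IsCPMap (Φ + Ψ) := by
  obtain ⟨m, B, hB⟩ := hΦ
  obtain ⟨n, C, hC⟩ := hΨ
  exact .of_fintype (Sum.elim B C) fun ρ => by simp [hB, hC]

lemma IsCPMap.comp {Φ Ψ : Matrix (Fin d) (Fin d) ℂ →ₗ[ℂ] Matrix (Fin d) (Fin d) ℂ}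
    (hΦ : IsCPMap Φ) (hΨ : IsCPMap Ψ) : IsCPMap (Φ ∘ₗ Ψ) := by
  obtain ⟨m, B, hB⟩ := hΦ
  obtain ⟨n, C, hC⟩ := hΨ
  refine .of_fintype (fun p : Fin m × Fin n => B p.1 * C p.2) fun ρ => ?_
  simp [hB, hC, Fintype.sum_prod_type, Finset.mul_sum, Finset.sum_mul, Matrix.mul_assoc]

/-- For positive semidefinite `A`, the matrices `S = A^{1/2}`, its Moore–Penrose inverse `T`,
and the projection `P` onto the kernel of `A`. -/
lemma exists_sqrt_pinv {A : Matrix (Fin d) (Fin d) ℂ} (hA : A.PosSemidef) :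
    ∃ S T P : Matrix (Fin d) (Fin d) ℂ,
      Tᴴ * A * T + Pᴴ * P = 1 ∧ P * S = 0 ∧ A * (1 - T * S) = 0 := by
  set W : Matrix (Fin d) (Fin d) ℂ := hA.1.eigenvectorUnitary.1
  set e := hA.1.eigenvalues with he
  have hWW : Wᴴ * W = 1 := Unitary.coe_star_mul_self hA.1.eigenvectorUnitary
  have hWW' : W * Wᴴ = 1 := Unitary.coe_mul_star_self hA.1.eigenvectorUnitary
  let D (f : ℝ → ℝ) : Matrix (Fin d) (Fin d) ℂ :=
    W * diagonal (fun i => ((f (e i) : ℝ) : ℂ)) * Wᴴ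
  have hD : ∀ f g, D f * D g = D (f * g) := fun f g => by
    calc D f * D g = W * diagonal (fun i => ((f (e i) : ℝ) : ℂ)) * (Wᴴ * W) *
          diagonal (fun i => ((g (e i) : ℝ) : ℂ)) * Wᴴ := by simp only [D, Matrix.mul_assoc]
      _ = D (f * g) := by
        simp only [D, hWW, Matrix.mul_one, Matrix.mul_assoc W, diagonal_mul_diagonal]
        simp
  have hDH : ∀ f, (D f)ᴴ = D f := fun f => by
    simp only [D, conjTranspose_mul, conjTranspose_conjTranspose, diagonal_conjTranspose,
      Matrix.mul_assoc]
    congr 3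
    ext i
    simp
  have hadd : ∀ f g, D f + D g = D (f + g) := fun f g => by
    simp only [D, ← Matrix.add_mul, ← Matrix.mul_add, diagonal_add]
    simp
  have hcongr : ∀ f g, (∀ x, 0 ≤ x → f x = g x) → D f = D g := fun f g h => by
    simp only [D, h _ (hA.eigenvalues_nonneg _), he]
  have hone : D 1 = 1 := by simp [D, hWW']
  have hzero : D 0 = 0 := by simp [D]
  have hAD : A = D id := hA.1.spectral_theorem
  clear_value D
  refine ⟨D Real.sqrt, D (fun x => (Real.sqrt x)⁻¹), D (fun x => if x = 0 then 1 else 0),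
    ?_, ?_, ?_⟩
  · rw [hDH, hDH, hAD, hD, hD, hD, hadd, ← hone]
    refine hcongr _ _ fun x hx => ?_
    rcases hx.eq_or_lt with rfl | hx
    · simp
    · have := (Real.sqrt_pos.2 hx).ne'
      simp only [Pi.add_apply, Pi.mul_apply, id, Pi.one_apply, hx.ne', if_false]
      field_simp
      simp [Real.sq_sqrt hx.le]
  · rw [hD, ← hzero]
    refine hcongr _ _ fun x _ => ?_
    by_cases h : x = 0 <;> simp [h]
  · rw [mul_sub, mul_one, hAD, hD, hD, sub_eq_zero]
    refine hcongr _ _ fun x hx => ?_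
    rcases hx.eq_or_lt with rfl | hx
    · simp
    · have := (Real.sqrt_pos.2 hx).ne'
      simp [this]

/-- A finite family of CP maps factors as a family with trace-preserving sum, precomposed with
a single CP map. -/
lemma exists_tracePreserving_factorization {ι : Type*} [DecidableEq ι]
    (L : Finset ι) {k : ι} (hk : k ∈ L)
    (U : ι → (Matrix (Fin d) (Fin d) ℂ →ₗ[ℂ] Matrix (Fin d) (Fin d) ℂ))
    (hU : ∀ i, IsCPMap (U i)) :
    ∃ (U' : ι → (Matrix (Fin d) (Fin d) ℂ →ₗ[ℂ] Matrix (Fin d) (Fin d) ℂ))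
      (C : Matrix (Fin d) (Fin d) ℂ →ₗ[ℂ] Matrix (Fin d) (Fin d) ℂ),
      (∀ i, IsCPMap (U' i)) ∧ IsCPMap C ∧
      (∀ ρ, (∑ i ∈ L, U' i ρ).trace = ρ.trace) ∧ ∀ i ∈ L, U' i ∘ₗ C = U i := by
  choose m B hB using hU
  set A : Matrix (Fin d) (Fin d) ℂ := ∑ i ∈ L, ∑ a, (B i a)ᴴ * B i a with hA
  have hApos : A.PosSemidef := posSemidef_sum _ fun i _ => posSemidef_sum _ fun a _ =>
    posSemidef_conjTranspose_mul_self _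
  obtain ⟨S, T, P, hTP, hPS, hATS⟩ := exists_sqrt_pinv hApos
  have hBTS : ∀ i ∈ L, ∀ a, B i a * T * S = B i a := by
    intro i hi a
    have h0 : ∑ i ∈ L, ∑ a, (B i a * (1 - T * S))ᴴ * (B i a * (1 - T * S)) = 0 := by
      calc _ = (1 - T * S)ᴴ * (A * (1 - T * S)) := by
            simp only [hA, Finset.mul_sum, Finset.sum_mul, conjTranspose_mul, Matrix.mul_assoc]
        _ = 0 := by rw [hATS, mul_zero]
    have htr := congrArg Matrix.trace h0
    rw [trace_sum, trace_zero] at htr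
    have hnn : ∀ i a, 0 ≤ ((B i a * (1 - T * S))ᴴ * (B i a * (1 - T * S))).trace := fun i a =>
      (posSemidef_conjTranspose_mul_self _).trace_nonneg
    rw [Finset.sum_eq_zero_iff_of_nonneg fun i _ => by
      rw [trace_sum]; exact Finset.sum_nonneg fun a _ => hnn i a] at htr
    have htr' := htr i hi
    rw [trace_sum, Finset.sum_eq_zero_iff_of_nonneg fun a _ => hnn i a] at htr'
    have := trace_conjTranspose_mul_self_eq_zero_iff.1 (htr' a (Finset.mem_univ a))
    rw [mul_sub, mul_one, sub_eq_zero, ← Matrix.mul_assoc] at this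
    exact this.symm
  refine ⟨fun i => U i ∘ₗ conjMap T + if i = k then conjMap P else 0, conjMap S, ?_,
    isCPMap_conjMap S, ?_, ?_⟩
  · intro i
    refine (IsCPMap.comp ⟨m i, B i, hB i⟩ (isCPMap_conjMap T)).add ?_
    split_ifs
    exacts [isCPMap_conjMap P, isCPMap_zero]
  · intro ρ
    have hP : ∑ i ∈ L, (if i = k then conjMap P else 0) ρ = P * ρ * Pᴴ := by
      rw [Finset.sum_eq_single_of_mem k hk fun i _ h => by simp [h]]
      simp [conjMap]
    have hUT : (∑ i ∈ L, U i (conjMap T ρ)).trace = (Tᴴ * A * T * ρ).trace := by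
      simp only [hB, conjMap, LinearMap.coe_mk, AddHom.coe_mk, hA, Finset.mul_sum, Finset.sum_mul,
        trace_sum]
      refine Finset.sum_congr rfl fun i _ => Finset.sum_congr rfl fun a _ => ?_
      rw [trace_mul_comm]
      simp only [← Matrix.mul_assoc]
      rw [trace_mul_comm]
      simp only [Matrix.mul_assoc]
    simp only [LinearMap.add_apply, LinearMap.comp_apply, Finset.sum_add_distrib, trace_add, hP,
      hUT]
    rw [trace_mul_comm (P * ρ), ← Matrix.mul_assoc, ← trace_add, ← Matrix.add_mul, hTP,
      Matrix.one_mul]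
  · intro i hi
    ext1 ρ
    have hP : (if i = k then conjMap P else 0) (conjMap S ρ) = 0 := by
      split_ifs
      · simp [conjMap, ← Matrix.mul_assoc, hPS]
      · simp
    simp only [LinearMap.add_apply, LinearMap.comp_apply, hP, add_zero, hB]
    refine Finset.sum_congr rfl fun a _ => ?_
    have h := hBTS i hi a
    calc B i a * (conjMap T (conjMap S ρ)) * (B i a)ᴴ
        = (B i a * T * S) * ρ * (B i a * T * S)ᴴ := by
          simp [conjMap, Matrix.mul_assoc]
      _ = _ := by rw [h]

lemma tomAct_eq_comp_iff
    {E F G : V → V → (Matrix (Fin d) (Fin d) ℂ →ₗ[ℂ] Matrix (Fin d) (Fin d) ℂ)} :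
    tomAct E = tomAct F ∘ₗ tomAct G ↔ ∀ i j, E i j = ∑ k, F i k ∘ₗ G k j := by
  constructor
  · intro h i j
    ext1 ρ
    have := congrFun (LinearMap.congr_fun h (Pi.single j ρ)) i
    have key : ∀ H : V → V → (Matrix (Fin d) (Fin d) ℂ →ₗ[ℂ] Matrix (Fin d) (Fin d) ℂ), ∀ i,
        tomAct H (Pi.single j ρ) i = H i j ρ := fun H i => by
      change ∑ l, H i l ((Pi.single j ρ : V → Matrix (Fin d) (Fin d) ℂ) l) = _
      rw [Fintype.sum_eq_single j fun l hl => by rw [Pi.single_eq_of_ne hl, map_zero],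
        Pi.single_eq_same]
    rw [key, LinearMap.comp_apply] at this
    rw [this, LinearMap.sum_apply]
    change ∑ k, F i k (tomAct G (Pi.single j ρ) k) = _
    simp only [key, LinearMap.comp_apply]
  · intro h
    refine LinearMap.ext fun ρ => funext fun i => ?_
    change ∑ j, E i j (ρ j) = ∑ k, F i k (∑ j, G k j (ρ j))
    simp only [h, LinearMap.sum_apply, LinearMap.comp_apply, map_sum]
    exact Finset.sum_comm

section Partition

variable {Vm V0 Vp : Finset V}
  {EL ER : V → V → (Matrix (Fin d) (Fin d) ℂ →ₗ[ℂ] Matrix (Fin d) (Fin d) ℂ)}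

lemma sum_extById_comp_of_mem_right (hd2 : Disjoint V0 Vp) (hd3 : Disjoint Vm Vp)
    (hL : ∀ i j, (i ∉ Vm ∪ V0 ∨ j ∉ Vm ∪ V0) → EL i j = 0) {i : V} (hi : i ∈ Vp) (j : V) :
    ∑ k, extById Vp EL i k ∘ₗ extById Vm ER k j = ER i j := by
  have hiL : i ∉ Vm ∪ V0 := by
    simp [Finset.disjoint_right.1 hd2 hi, Finset.disjoint_right.1 hd3 hi]
  rw [Fintype.sum_eq_single i fun k hk => by simp [extById, hL i k (.inl hiL), hk.symm]]
  ext1 ρ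
  simp [extById, hL i i (.inl hiL), hi, Finset.disjoint_right.1 hd3 hi]

lemma sum_extById_comp_of_mem_left (hd1 : Disjoint Vm V0) (hd3 : Disjoint Vm Vp)
    (hR : ∀ i j, (i ∉ V0 ∪ Vp ∨ j ∉ V0 ∪ Vp) → ER i j = 0) (i : V) {j : V} (hj : j ∈ Vm) :
    ∑ k, extById Vp EL i k ∘ₗ extById Vm ER k j = EL i j := by
  have hjR : j ∉ V0 ∪ Vp := by
    simp [Finset.disjoint_left.1 hd1 hj, Finset.disjoint_left.1 hd3 hj]
  rw [Fintype.sum_eq_single j fun k hk => by simp [extById, hR k j (.inr hjR), hk]]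
  have : ¬ (i = j ∧ i ∈ Vp) := by
    rintro ⟨rfl, h⟩
    exact Finset.disjoint_left.1 hd3 hj h
  ext1 ρ
  simp [extById, hR j j (.inr hjR), hj, this]

lemma sum_extById_comp_of_mem_block (hd1 : Disjoint Vm V0) (hd2 : Disjoint V0 Vp)
    (hd3 : Disjoint Vm Vp)
    (hL : ∀ i j, (i ∉ Vm ∪ V0 ∨ j ∉ Vm ∪ V0) → EL i j = 0)
    (hR : ∀ i j, (i ∉ V0 ∪ Vp ∨ j ∉ V0 ∪ Vp) → ER i j = 0)
    {i j : V} (hi : i ∈ Vm ∪ V0) (hj : j ∈ V0 ∪ Vp) :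
    ∑ k, extById Vp EL i k ∘ₗ extById Vm ER k j = ∑ k ∈ V0, EL i k ∘ₗ ER k j := by
  have hip : i ∉ Vp := Finset.disjoint_left.1 (Finset.disjoint_union_left.2 ⟨hd3, hd2⟩) hi
  have hjm : j ∉ Vm := Finset.disjoint_right.1 (Finset.disjoint_union_right.2 ⟨hd1, hd3⟩) hj
  have hterm : ∀ k, extById Vp EL i k ∘ₗ extById Vm ER k j = EL i k ∘ₗ ER k j := fun k => by
    have : ¬ (k = j ∧ k ∈ Vm) := by
      rintro ⟨rfl, h⟩
      exact hjm h
    simp [extById, hip, this]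
  simp only [hterm]
  refine (Finset.sum_subset (Finset.subset_univ V0) fun k _ hk => ?_).symm
  by_cases hkm : k ∈ Vm
  · rw [hR k j (.inl (by simp [hk, Finset.disjoint_left.1 hd3 hkm])), LinearMap.comp_zero]
  · rw [hL i k (.inr (by simp [hk, hkm])), LinearMap.zero_comp]

end Partition

/-- Characterization of overlapping factorizations: a TOM `E`
admits an overlapping factorization `E = (E_L ⊕ I₊)(I₋ ⊕ E_R)` with overlap `V₀`
along the partition `V = V₋ ∪ V₀ ∪ V₊` iff (i) `E_i^j = 0` for `i ∈ V₊, j ∈ V₋`,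
and (ii) the columns of the block `(E_i^j)_{i∈V_L, j∈V_R}` lie in the cone
spanned by `|V₀|` CP vectors: `E_i^j = Σ_{k∈V₀} U_i^k ∘ Φ_k^j` for CP maps
`U_i^k`, `Φ_k^j`. -/
theorem tom_overlapping_factorization_iff
    (Vm V0 Vp : Finset V)
    (hd1 : Disjoint Vm V0) (hd2 : Disjoint V0 Vp) (hd3 : Disjoint Vm Vp)
    (hcover : Vm ∪ V0 ∪ Vp = Finset.univ)
    (E : V → V → (Matrix (Fin d) (Fin d) ℂ →ₗ[ℂ] Matrix (Fin d) (Fin d) ℂ))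
    (hE : IsTOMOn Finset.univ E) :
    (∃ EL ER : V → V → (Matrix (Fin d) (Fin d) ℂ →ₗ[ℂ] Matrix (Fin d) (Fin d) ℂ),
      IsTOMOn (Vm ∪ V0) EL ∧ IsTOMOn (V0 ∪ Vp) ER ∧
      tomAct E = (tomAct (extById Vp EL)) ∘ₗ (tomAct (extById Vm ER))) ↔
    ((∀ i j, i ∈ Vp → j ∈ Vm → E i j = 0) ∧
     (∃ U Ψ : V → V → (Matrix (Fin d) (Fin d) ℂ →ₗ[ℂ] Matrix (Fin d) (Fin d) ℂ),
        (∀ i k, IsCPMap (U i k)) ∧ (∀ k j, IsCPMap (Ψ k j)) ∧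
        ∀ i ∈ Vm ∪ V0, ∀ j ∈ V0 ∪ Vp,
          E i j = ∑ k ∈ V0, (U i k) ∘ₗ (Ψ k j))) := by
  have hcov : ∀ i, i ∈ Vm ∪ V0 ∨ i ∈ Vp := fun i => by
    rw [← Finset.mem_union, hcover]
    exact Finset.mem_univ i
  have hdL : Disjoint (Vm ∪ V0) Vp := Finset.disjoint_union_left.2 ⟨hd3, hd2⟩
  have hdR : Disjoint Vm (V0 ∪ Vp) := Finset.disjoint_union_right.2 ⟨hd1, hd3⟩
  have hsplit : ∀ f : V → Matrix (Fin d) (Fin d) ℂ,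
      ∑ i, f i = ∑ i ∈ Vm ∪ V0, f i + ∑ i ∈ Vp, f i := fun f => by
    rw [← Finset.sum_union hdL, hcover]
  obtain ⟨hEcp, -, hEtr⟩ := hE
  constructor
  · rintro ⟨EL, ER, ⟨hLcp, hL, -⟩, ⟨hRcp, hR, -⟩, hfac⟩
    rw [tomAct_eq_comp_iff] at hfac
    refine ⟨fun i j hi hj => ?_, EL, ER, hLcp, hRcp, fun i hi j hj => ?_⟩
    · rw [hfac, sum_extById_comp_of_mem_right hd2 hd3 hL hi]
      exact hR i j (.inr (Finset.disjoint_left.1 hdR hj))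
    · rw [hfac, sum_extById_comp_of_mem_block hd1 hd2 hd3 hL hR hi hj]
  · rintro ⟨hzero, U, Ψ, hU, hΨ, hblock⟩
    have hnorm := fun k (hk : k ∈ V0) => exists_tracePreserving_factorization (Vm ∪ V0)
      (Finset.mem_union_right Vm hk) (fun i => U i k) (fun i => hU i k)
    choose! U' C hU' hC htr hfac using hnorm
    let EL : V → V → (Matrix (Fin d) (Fin d) ℂ →ₗ[ℂ] Matrix (Fin d) (Fin d) ℂ) := fun i j =>
      if i ∈ Vm ∪ V0 then if j ∈ Vm then E i j else if j ∈ V0 then U' j i else 0 else 0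
    let ER : V → V → (Matrix (Fin d) (Fin d) ℂ →ₗ[ℂ] Matrix (Fin d) (Fin d) ℂ) := fun i j =>
      if j ∈ V0 ∪ Vp then if i ∈ V0 then C i ∘ₗ Ψ i j else if i ∈ Vp then E i j else 0 else 0
    have hL : ∀ i j, (i ∉ Vm ∪ V0 ∨ j ∉ Vm ∪ V0) → EL i j = 0 := by
      rintro i j (h | h)
      · exact if_neg h
      · rw [Finset.mem_union, not_or] at h
        simp [EL, h.1, h.2]
    have hR : ∀ i j, (i ∉ V0 ∪ Vp ∨ j ∉ V0 ∪ Vp) → ER i j = 0 := by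
      rintro i j (h | h)
      · rw [Finset.mem_union, not_or] at h
        simp [ER, h.1, h.2]
      · exact if_neg h
    have hELm : ∀ i ∈ Vm ∪ V0, ∀ j ∈ Vm, EL i j = E i j := fun i hi j hj => by
      simp only [EL, if_pos hi, if_pos hj]
    have hEL0 : ∀ i ∈ Vm ∪ V0, ∀ j ∈ V0, EL i j = U' j i := fun i hi j hj => by
      simp only [EL, if_pos hi, if_pos hj, if_neg (Finset.disjoint_right.1 hd1 hj)]
    have hER0 : ∀ i ∈ V0, ∀ j ∈ V0 ∪ Vp, ER i j = C i ∘ₗ Ψ i j := fun i hi j hj => by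
      simp only [ER, if_pos hi, if_pos hj]
    have hERp : ∀ i ∈ Vp, ∀ j ∈ V0 ∪ Vp, ER i j = E i j := fun i hi j hj => by
      simp only [ER, if_pos hi, if_pos hj, if_neg (Finset.disjoint_right.1 hd2 hi)]
    have hprod : ∀ i ∈ Vm ∪ V0, ∀ j ∈ V0 ∪ Vp, E i j = ∑ k ∈ V0, EL i k ∘ₗ ER k j := by
      intro i hi j hj
      rw [hblock i hi j hj]
      refine Finset.sum_congr rfl fun k hk => ?_
      rw [hEL0 i hi k hk, hER0 k hk j hj, ← LinearMap.comp_assoc, hfac k hk i hi]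
    have hLsum : ∀ j ρ, ∑ i, EL i j ρ = ∑ i ∈ Vm ∪ V0, EL i j ρ := fun j ρ => by
      rw [hsplit, Finset.sum_eq_zero (s := Vp) fun i hi => by
        rw [hL i j (.inl (Finset.disjoint_right.1 hdL hi)), LinearMap.zero_apply], add_zero]
    have hLtr0 : ∀ j ∈ V0, ∀ ρ, (∑ i ∈ Vm ∪ V0, EL i j ρ).trace = ρ.trace := fun j hj ρ => by
      rw [← htr j hj ρ]
      exact congrArg _ (Finset.sum_congr rfl fun i hi => by rw [hEL0 i hi j hj])
    refine ⟨EL, ER, ⟨fun i j => ?_, hL, fun j hj ρ => ?_⟩,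
      ⟨fun i j => ?_, hR, fun j hj ρ => ?_⟩, ?_⟩
    · simp only [EL]
      split_ifs with h1 h2 h3
      exacts [hEcp i j, hU' j h3 i, isCPMap_zero, isCPMap_zero]
    · rw [hLsum]
      rcases Finset.mem_union.1 hj with hj | hj
      · rw [← hEtr j (Finset.mem_univ j) ρ, hsplit, Finset.sum_eq_zero (s := Vp) fun i hi => by
          rw [hzero i j hi hj, LinearMap.zero_apply], add_zero]
        exact congrArg _ (Finset.sum_congr rfl fun i hi => by rw [hELm i hi j hj])
      · exact hLtr0 j hj ρ
    · simp only [ER]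
      split_ifs with h1 h2 h3
      exacts [(hC i h2).comp (hΨ i j), hEcp i j, isCPMap_zero, isCPMap_zero]
    · rw [← hEtr j (Finset.mem_univ j) ρ, hsplit, hsplit, trace_add, trace_add]
      congr 1
      · have hE : ∑ i ∈ Vm ∪ V0, E i j ρ = ∑ k ∈ V0, ∑ i ∈ Vm ∪ V0, EL i k (ER k j ρ) := by
          rw [Finset.sum_comm]
          refine Finset.sum_congr rfl fun i hi => ?_
          rw [hprod i hi j hj, LinearMap.sum_apply]
          rfl
        rw [hE, Finset.sum_union hd1, Finset.sum_eq_zero (s := Vm) fun i hi => by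
          rw [hR i j (.inl (Finset.disjoint_left.1 hdR hi)), LinearMap.zero_apply], zero_add,
          trace_sum, trace_sum]
        exact Finset.sum_congr rfl fun k hk => (hLtr0 k hk _).symm
      · exact congrArg _ (Finset.sum_congr rfl fun i hi => by rw [hERp i hi j hj])
    · rw [tomAct_eq_comp_iff]
      intro i j
      by_cases hj : j ∈ Vm
      · rw [sum_extById_comp_of_mem_left hd1 hd3 hR i hj]
        rcases hcov i with hi | hi
        · exact (hELm i hi j hj).symm
        · rw [hzero i j hi hj, hL i j (.inl (Finset.disjoint_right.1 hdL hi))]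
      · have hjR : j ∈ V0 ∪ Vp := by
          have := hcov j
          simp only [Finset.mem_union] at this ⊢
          tauto
        rcases hcov i with hi | hi
        · rw [sum_extById_comp_of_mem_block hd1 hd2 hd3 hL hR hi hjR, hprod i hi j hjR]
        · rw [sum_extById_comp_of_mem_right hd2 hd3 hL hi, hERp i hi j hjR]

end QMCTOM
end
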